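/- Consistency of the Strang splitting with rational time discretization: Let X, X_m, P_m, J_m form an approximation scheme, let A, A_m and B, B_m each be stable and consistent approximating families of operators, and let r and q be rational functions with r(0) = r'(0) = 1, q(0) = q'(0) = 1, bounded on the closed left half-plane ℂ₋, with r(hA_m), q(hB_m) defined via partial fraction decompositions. Then for every x ∈ D(A) ∩ D(B), ‖( J_m r((h/2) A_m) q(h B_m) r((h/2) A_m) P_m x − J_m P_m x )/h − J_m (A_m + B_m) P_m x‖ → 0 as h → 0+, uniformly in m ∈ ℕ. -/

import Mathlib

open Filter Topology

/-- `R` is the resolvent operator `R(lam, A) = (lam - A)⁻¹` of the (possibly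
unbounded) linear operator `A`, given as a partially defined linear map. -/
structure IsResolvent {Y : Type*} [NormedAddCommGroup Y] [NormedSpace ℂ Y]
    (A : Y →ₗ.[ℂ] Y) (lam : ℂ) (R : Y →L[ℂ] Y) : Prop where
  mem : ∀ x : Y, R x ∈ A.domain
  eq_right : ∀ x : Y, lam • R x - A ⟨R x, mem x⟩ = x
  eq_left : ∀ y : A.domain, R (lam • (y : Y) - A y) = (y : Y)

/-- The operator `r(h A)` where the rational function `r` is given through its partial
fraction decomposition `r(z) = Σ_{i,j} C i j • (1 - z/lam i)⁻ʲ` and the operator `A`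
through its resolvent family `R`:  `r(h A) = Σ_{i,j} C i j • [(lam i/h) R(lam i/h, A)]ʲ`.
(For `h ≤ 0` it is defined to be the identity, corresponding to `r(0·A) = I`.) -/
noncomputable def ratOp {Y : Type*} [NormedAddCommGroup Y] [NormedSpace ℂ Y]
    (l : ℕ) (ν : Fin l → ℕ) (lam : Fin l → ℂ) (C : Fin l → ℕ → ℂ)
    (R : ℂ → Y →L[ℂ] Y) (h : ℝ) : Y →L[ℂ] Y :=
  if h ≤ 0 then 1 else
    ∑ i, ∑ j ∈ Finset.Icc 1 (ν i), C i j • ((lam i / (h : ℂ)) • R (lam i / (h : ℂ))) ^ j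

/-- The rational function `r(z) = Σ_{i,j} C i j (1 - z/lam i)⁻ʲ` given by a partial
fraction decomposition. -/
noncomputable def pfdFun (l : ℕ) (ν : Fin l → ℕ) (lam : Fin l → ℂ) (C : Fin l → ℕ → ℂ)
    (z : ℂ) : ℂ :=
  ∑ i, ∑ j ∈ Finset.Icc 1 (ν i), C i j * (1 - z / lam i) ^ (-(j : ℤ))

/-- The family `v m h` tends to `0` as `h → 0+`, uniformly in the index `m`. -/
def UniformlyVanishing {Y : ℕ → Type*} [∀ m, NormedAddCommGroup (Y m)]
    (v : ∀ m, ℝ → Y m) : Prop :=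
  ∀ ε > (0 : ℝ), ∀ᶠ h in 𝓝[>] (0 : ℝ), ∀ m, ‖v m h‖ ≤ ε

/-- The family `u` can be approximated, uniformly in `m`, by elements of the domains of `A m`
whose images under `A m` are bounded uniformly in `m`. -/
def DomainApproximable {Y : ℕ → Type*} [∀ m, NormedAddCommGroup (Y m)]
    [∀ m, NormedSpace ℂ (Y m)] (A : ∀ m, Y m →ₗ.[ℂ] Y m) (u : ∀ m, Y m) : Prop :=
  ∀ ε > (0 : ℝ), ∃ b : ℝ, ∀ m, ∃ w : (A m).domain, ‖u m - w‖ ≤ ε ∧ ‖A m w‖ ≤ b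

namespace UniformlyVanishing

variable {Y : ℕ → Type*} [∀ m, NormedAddCommGroup (Y m)] {v w : ∀ m, ℝ → Y m}

theorem zero : UniformlyVanishing (fun m _ => (0 : Y m)) := fun ε hε =>
  Eventually.of_forall fun _ _ => by simpa using hε.le

theorem add (hv : UniformlyVanishing v) (hw : UniformlyVanishing w) :
    UniformlyVanishing (fun m h => v m h + w m h) := fun ε hε => by
  filter_upwards [hv (ε / 2) (half_pos hε), hw (ε / 2) (half_pos hε)] with h h1 h2 m
  exact (norm_add_le _ _).trans (by linarith [h1 m, h2 m])

theorem sum {ι : Type*} (s : Finset ι) {f : ι → ∀ m, ℝ → Y m}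
    (hf : ∀ i ∈ s, UniformlyVanishing (f i)) :
    UniformlyVanishing (fun m h => ∑ i ∈ s, f i m h) := by
  classical
  induction s using Finset.induction_on with
  | empty => simpa using zero
  | insert a s ha ih =>
    simp only [Finset.sum_insert ha]
    exact (hf a (Finset.mem_insert_self a s)).add
      (ih fun i hi => hf i (Finset.mem_insert_of_mem hi))

theorem congr (hv : UniformlyVanishing v) (hvw : ∀ m, ∀ h > 0, v m h = w m h) :
    UniformlyVanishing w := fun ε hε => by
  filter_upwards [hv ε hε, self_mem_nhdsWithin] with h h1 h2 m
  exact hvw m h h2 ▸ h1 m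

theorem comp_half (hv : UniformlyVanishing v) :
    UniformlyVanishing (fun m h => v m (h / 2)) := fun ε hε => by
  have ht : Tendsto (fun h : ℝ => h / 2) (𝓝[>] 0) (𝓝[>] 0) := by
    refine tendsto_nhdsWithin_iff.2 ⟨?_, ?_⟩
    · have : Tendsto (fun h : ℝ => h / 2) (𝓝 0) (𝓝 (0 / 2)) := tendsto_id.div_const 2
      rw [zero_div] at this
      exact this.mono_left nhdsWithin_le_nhds
    · filter_upwards [self_mem_nhdsWithin] with h hh
      exact half_pos (Set.mem_Ioi.1 hh)
  exact ht.eventually (hv ε hε)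

variable {Z : ℕ → Type*} [∀ m, NormedSpace ℂ (Y m)]
  [∀ m, NormedAddCommGroup (Z m)] [∀ m, NormedSpace ℂ (Z m)]

theorem map {T : ∀ m, ℝ → Y m →L[ℂ] Z m} {c : ℝ} (hT : ∀ m, ∀ h > 0, ‖T m h‖ ≤ c)
    (hv : UniformlyVanishing v) : UniformlyVanishing (fun m h => T m h (v m h)) := fun ε hε => by
  have hc : 0 < |c| + 1 := by positivity
  filter_upwards [hv (ε / (|c| + 1)) (by positivity), self_mem_nhdsWithin] with h h1 h2 m
  calc ‖T m h (v m h)‖ ≤ (|c| + 1) * (ε / (|c| + 1)) :=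
        (T m h).le_of_opNorm_le_of_le
          (((hT m h h2).trans (le_abs_self c)).trans (by linarith)) (h1 m)
    _ = ε := by field_simp

theorem smul (c : ℂ) (hv : UniformlyVanishing v) :
    UniformlyVanishing (fun m h => c • v m h) :=
  hv.map (T := fun m _ => c • ContinuousLinearMap.id ℂ (Y m)) (c := ‖c‖) fun m h _ => by
    rw [norm_smul]
    exact mul_le_of_le_one_right (norm_nonneg _) ContinuousLinearMap.norm_id_le

end UniformlyVanishing

theorem sum_eq_one_of_pfdFun_zero {l : ℕ} {ν : Fin l → ℕ} {lam : Fin l → ℂ}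
    {C : Fin l → ℕ → ℂ} (h0 : pfdFun l ν lam C 0 = 1) :
    ∑ i, ∑ j ∈ Finset.Icc 1 (ν i), C i j = 1 := by
  simpa [pfdFun] using h0

theorem hasDerivAt_pfdFun_zero (l : ℕ) (ν : Fin l → ℕ) (lam : Fin l → ℂ)
    (C : Fin l → ℕ → ℂ) :
    HasDerivAt (pfdFun l ν lam C)
      (∑ i, ∑ j ∈ Finset.Icc 1 (ν i), C i j * (j / lam i)) 0 := by
  unfold pfdFun
  refine HasDerivAt.fun_sum fun i _ => HasDerivAt.fun_sum fun j _ => ?_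
  have h1 : HasDerivAt (fun z : ℂ => 1 - z / lam i) (-(1 / lam i)) 0 :=
    ((hasDerivAt_id (0 : ℂ)).div_const (lam i)).const_sub 1
  have h2 := (hasDerivAt_zpow (-(j : ℤ)) (1 - 0 / lam i) (Or.inl (by simp))).comp 0 h1
  refine (h2.const_mul (C i j)).congr_deriv ?_
  simp [div_eq_mul_inv]

theorem sum_eq_one_of_hasDerivAt_pfdFun {l : ℕ} {ν : Fin l → ℕ} {lam : Fin l → ℂ}
    {C : Fin l → ℕ → ℂ} (h1 : HasDerivAt (pfdFun l ν lam C) 1 0) :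
    ∑ i, ∑ j ∈ Finset.Icc 1 (ν i), C i j * (j / lam i) = 1 :=
  (hasDerivAt_pfdFun_zero l ν lam C).unique h1

section Resolvent

variable {E : Type*} [NormedAddCommGroup E] [NormedSpace ℂ E] {A : E →ₗ.[ℂ] E}

theorem re_div_ofReal_pos {μ : ℂ} (hμ : 0 < μ.re) {h : ℝ} (hh : 0 < h) :
    0 < (μ / (h : ℂ)).re := by
  rw [Complex.div_ofReal_re]
  exact div_pos hμ hh

/-- `μ R(μ, A) y - y = R(μ, A) A y`, with `μ` rescaled by `h`. -/
theorem IsResolvent.smul_apply_sub {μ : ℂ} (hμ : μ ≠ 0) {h : ℝ} (hh : h ≠ 0) {R : E →L[ℂ] E}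
    (hR : IsResolvent A (μ / h) R) (y : A.domain) :
    ((μ / (h : ℂ)) • R) y - y = ((h : ℂ) / μ) • ((μ / (h : ℂ)) • R) (A y) := by
  have h1 := hR.eq_left y
  rw [map_sub, map_smul, sub_eq_iff_eq_add] at h1
  have hh' : (h : ℂ) ≠ 0 := Complex.ofReal_ne_zero.2 hh
  have h2 : (h : ℂ) / μ * (μ / h) = 1 := by field_simp
  rw [smul_apply, smul_apply, smul_smul, h2, one_smul, h1,
    add_sub_cancel_left]

theorem norm_smul_resolvent_le {R : ℂ → E →L[ℂ] E} {M : ℝ}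
    (hR : ∀ z : ℂ, 0 < z.re → z.re * ‖R z‖ ≤ M) {μ : ℂ} (hμ : 0 < μ.re) {h : ℝ} (hh : 0 < h) :
    ‖(μ / (h : ℂ)) • R (μ / h)‖ ≤ ‖μ‖ / μ.re * M := by
  have h1 := hR (μ / h) (re_div_ofReal_pos hμ hh)
  rw [Complex.div_ofReal_re] at h1
  rw [norm_smul, norm_div, Complex.norm_real, Real.norm_of_nonneg hh.le]
  calc ‖μ‖ / h * ‖R (μ / h)‖ = ‖μ‖ / μ.re * (μ.re / h * ‖R (μ / h)‖) := by field_simp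
    _ ≤ ‖μ‖ / μ.re * M := by gcongr

end Resolvent

section Family

variable {Y : ℕ → Type*} [∀ m, NormedAddCommGroup (Y m)] [∀ m, NormedSpace ℂ (Y m)]
  {A : ∀ m, Y m →ₗ.[ℂ] Y m} {R : ∀ m, ℂ → Y m →L[ℂ] Y m} {M : ℝ}

theorem uniformlyVanishing_smul_resolvent
    (hR : ∀ m, ∀ z : ℂ, 0 < z.re → IsResolvent (A m) z (R m z) ∧ z.re * ‖R m z‖ ≤ M)
    {u : ∀ m, Y m} (hu : DomainApproximable A u) {μ : ℂ} (hμ : 0 < μ.re) :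
    UniformlyVanishing (fun m h => ((μ / (h : ℂ)) • R m (μ / h)) (u m) - u m) := by
  intro ε hε
  have hμ0 : μ ≠ 0 := by rintro rfl; simp at hμ
  set c : ℝ := |‖μ‖ / μ.re * M|
  have hc0 : 0 ≤ c := abs_nonneg _
  obtain ⟨b, hb⟩ := hu (ε / (2 * (c + 1))) (by positivity)
  have ht : Tendsto (fun h : ℝ => h / ‖μ‖ * (c * |b|)) (𝓝[>] 0) (𝓝 0) := by
    have : Continuous (fun h : ℝ => h / ‖μ‖ * (c * |b|)) := by fun_prop
    simpa using (this.tendsto 0).mono_left nhdsWithin_le_nhds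
  filter_upwards [ht.eventually_le_const (half_pos hε), self_mem_nhdsWithin] with h h1 hh m
  have hh : 0 < h := hh
  obtain ⟨w, hw, hAw⟩ := hb m
  set T := (μ / (h : ℂ)) • R m (μ / h)
  have hT : ‖T‖ ≤ c :=
    (norm_smul_resolvent_le (fun z hz => (hR m z hz).2) hμ hh).trans (le_abs_self _)
  have hres : T w - w = ((h : ℂ) / μ) • T (A m w) :=
    (hR m _ (re_div_ofReal_pos hμ hh)).1.smul_apply_sub hμ0 hh.ne' w
  have hsplit : T (u m) - u m = T (u m - w) - (u m - w) + ((h : ℂ) / μ) • T (A m w) := by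
    rw [← hres, map_sub]; abel
  have e1 : ‖T (u m - w)‖ ≤ c * (ε / (2 * (c + 1))) := T.le_of_opNorm_le_of_le hT hw
  have e2 : ‖((h : ℂ) / μ) • T (A m w)‖ ≤ h / ‖μ‖ * (c * |b|) := by
    rw [norm_smul, norm_div, Complex.norm_real, Real.norm_of_nonneg hh.le]
    gcongr
    exact T.le_of_opNorm_le_of_le hT (hAw.trans (le_abs_self b))
  have e3 : c * (ε / (2 * (c + 1))) + ε / (2 * (c + 1)) = ε / 2 := by field_simp
  rw [hsplit]
  refine (norm_add_le _ _).trans ?_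
  have := norm_sub_le (T (u m - w)) (u m - w)
  linarith

theorem uniformlyVanishing_smul_resolvent_pow
    (hR : ∀ m, ∀ z : ℂ, 0 < z.re → IsResolvent (A m) z (R m z) ∧ z.re * ‖R m z‖ ≤ M)
    {u : ∀ m, Y m} (hu : DomainApproximable A u) {μ : ℂ} (hμ : 0 < μ.re) (k : ℕ) :
    UniformlyVanishing (fun m h => (((μ / (h : ℂ)) • R m (μ / h)) ^ k) (u m) - u m) := by
  induction k with
  | zero => simpa using UniformlyVanishing.zero
  | succ k ih =>
    refine ((ih.map fun m h hh => norm_smul_resolvent_le (fun z hz => (hR m z hz).2) hμ hh).add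
      (uniformlyVanishing_smul_resolvent hR hu hμ)).congr fun m h _ => ?_
    rw [pow_succ', mul_apply_eq_comp, map_sub, sub_add_sub_cancel]

variable {l : ℕ} {ν : Fin l → ℕ} {lam : Fin l → ℂ} {C : Fin l → ℕ → ℂ}

theorem ratOp_apply_of_pos {E : Type*} [NormedAddCommGroup E] [NormedSpace ℂ E]
    (R : ℂ → E →L[ℂ] E) {h : ℝ} (hh : 0 < h) (y : E) :
    ratOp l ν lam C R h y = ∑ i, ∑ j ∈ Finset.Icc 1 (ν i),
      C i j • (((lam i / (h : ℂ)) • R (lam i / h)) ^ j) y := by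
  simp [ratOp, not_le.2 hh]

theorem exists_norm_ratOp_le
    (hR : ∀ m, ∀ z : ℂ, 0 < z.re → IsResolvent (A m) z (R m z) ∧ z.re * ‖R m z‖ ≤ M)
    (hlam : ∀ i, 0 < (lam i).re) :
    ∃ c, ∀ m, ∀ h > 0, ‖ratOp l ν lam C (R m) h‖ ≤ c := by
  refine ⟨∑ i, ∑ j ∈ Finset.Icc 1 (ν i), ‖C i j‖ * (‖lam i‖ / (lam i).re * M) ^ j,
    fun m h hh => ?_⟩
  rw [ratOp, if_neg (not_le.2 hh)]
  refine norm_sum_le_of_le _ fun i _ => norm_sum_le_of_le _ fun j hj => ?_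
  rw [norm_smul]
  gcongr
  refine (norm_pow_le' _ (Finset.mem_Icc.1 hj).1).trans ?_
  gcongr
  exact norm_smul_resolvent_le (fun z hz => (hR m z hz).2) (hlam i) hh

theorem uniformlyVanishing_ratOp_sub
    (hR : ∀ m, ∀ z : ℂ, 0 < z.re → IsResolvent (A m) z (R m z) ∧ z.re * ‖R m z‖ ≤ M)
    (hlam : ∀ i, 0 < (lam i).re) (h0 : pfdFun l ν lam C 0 = 1)
    {u : ∀ m, Y m} (hu : DomainApproximable A u) :
    UniformlyVanishing (fun m h => ratOp l ν lam C (R m) h (u m) - u m) := by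
  refine (UniformlyVanishing.sum Finset.univ fun i _ =>
    UniformlyVanishing.sum (Finset.Icc 1 (ν i)) fun j _ =>
      (uniformlyVanishing_smul_resolvent_pow hR hu (hlam i) j).smul (C i j)).congr
    fun m h hh => ?_
  rw [ratOp_apply_of_pos _ hh]
  simp only [smul_sub, Finset.sum_sub_distrib, ← Finset.sum_smul]
  rw [sum_eq_one_of_pfdFun_zero h0, one_smul]

/-- The difference quotient `(r(hA) y - y) / h` tends to `A y`, uniformly in the index. -/
theorem uniformlyVanishing_ratOp_quotient
    (hR : ∀ m, ∀ z : ℂ, 0 < z.re → IsResolvent (A m) z (R m z) ∧ z.re * ‖R m z‖ ≤ M)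
    (hlam : ∀ i, 0 < (lam i).re) (h0 : pfdFun l ν lam C 0 = 1)
    (h1 : HasDerivAt (pfdFun l ν lam C) 1 0)
    {y : ∀ m, (A m).domain} (hy : DomainApproximable A fun m => A m (y m)) :
    UniformlyVanishing (fun m h =>
      (h : ℂ)⁻¹ • (ratOp l ν lam C (R m) h (y m) - (y m : Y m)) - A m (y m)) := by
  refine (UniformlyVanishing.sum Finset.univ fun i _ =>
    UniformlyVanishing.sum (Finset.Icc 1 (ν i)) fun j _ =>
      (UniformlyVanishing.sum (Finset.range j) fun k _ =>
        uniformlyVanishing_smul_resolvent_pow hR hy (hlam i) (k + 1)).smul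
          (C i j / lam i)).congr fun m h hh => ?_
  have hh' : (h : ℂ) ≠ 0 := Complex.ofReal_ne_zero.2 (ne_of_gt hh)
  have telescope : ∀ i, ∀ j : ℕ, (((lam i / (h : ℂ)) • R m (lam i / h)) ^ j) (y m : Y m) - y m =
      ((h : ℂ) / lam i) • ∑ k ∈ Finset.range j,
        (((lam i / (h : ℂ)) • R m (lam i / h)) ^ (k + 1)) (A m (y m)) := by
    intro i j
    have hi : lam i ≠ 0 := fun hi => by simpa [hi] using hlam i
    have hres := (hR m _ (re_div_ofReal_pos (hlam i) hh)).1.smul_apply_sub hi (ne_of_gt hh) (y m)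
    have htel := Finset.sum_range_sub
      (fun k => (((lam i / (h : ℂ)) • R m (lam i / h)) ^ k) (y m : Y m)) j
    rw [pow_zero, one_apply_eq_self] at htel
    rw [← htel, Finset.smul_sum]
    refine Finset.sum_congr rfl fun k _ => ?_
    rw [pow_succ, mul_apply_eq_comp, mul_apply_eq_comp, ← map_sub, hres,
      map_smul]
  have hdiff : ratOp l ν lam C (R m) h (y m) - (y m : Y m) =
      ∑ i, ∑ j ∈ Finset.Icc 1 (ν i),
        C i j • ((((lam i / (h : ℂ)) • R m (lam i / h)) ^ j) (y m : Y m) - y m) := by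
    rw [ratOp_apply_of_pos _ hh]
    simp only [smul_sub, Finset.sum_sub_distrib, ← Finset.sum_smul]
    rw [sum_eq_one_of_pfdFun_zero h0, one_smul]
  have hA : A m (y m) = ∑ i, ∑ j ∈ Finset.Icc 1 (ν i), (C i j * (j / lam i)) • A m (y m) := by
    simp only [← Finset.sum_smul]
    rw [sum_eq_one_of_hasDerivAt_pfdFun h1, one_smul]
  rw [hdiff]
  conv_rhs => rw [hA]
  simp only [Finset.smul_sum, ← Finset.sum_sub_distrib]
  refine Finset.sum_congr rfl fun i _ => Finset.sum_congr rfl fun j _ => ?_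
  rw [telescope, Finset.smul_sum, ← Finset.smul_sum, ← Finset.smul_sum, smul_smul, smul_smul,
    Finset.sum_sub_distrib, smul_sub, Finset.sum_const, Finset.card_range,
    ← Nat.cast_smul_eq_nsmul ℂ, smul_smul]
  congr 2 <;> field_simp

end Family

theorem domainApproximable_of_tendsto
    {X : Type*} [NormedAddCommGroup X] [NormedSpace ℂ X]
    {Y : ℕ → Type*} [∀ m, NormedAddCommGroup (Y m)] [∀ m, NormedSpace ℂ (Y m)]
    {P : ∀ m, X →L[ℂ] Y m} {J : ∀ m, Y m →L[ℂ] X} (hPJ : ∀ m (y : Y m), P m (J m y) = y)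
    {K : ℝ} (hK : 0 < K) (hP : ∀ m, ‖P m‖ ≤ K)
    {A : X →ₗ.[ℂ] X} (hA : Dense (A.domain : Set X))
    {Am : ∀ m, Y m →ₗ.[ℂ] Y m} (hAm : ∀ m, Dense ((Am m).domain : Set (Y m)))
    (hdom : ∀ m, ∀ x ∈ A.domain, P m x ∈ (Am m).domain)
    (hcons : ∀ x : A.domain,
      Tendsto (fun m => J m ((Am m) ⟨P m (x : X), hdom m x x.2⟩)) atTop (𝓝 (A x)))
    {u : ∀ m, Y m} {z : X} (hu : Tendsto (fun m => J m (u m)) atTop (𝓝 z)) :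
    DomainApproximable Am u := by
  intro ε hε
  have hP' : ∀ m (y : Y m) (x : X), ‖y - P m x‖ ≤ K * ‖J m y - x‖ := fun m y x => by
    simpa [hPJ] using (P m).le_of_opNorm_le (hP m) (J m y - x)
  obtain ⟨x, hx, hzx⟩ := hA.exists_dist_lt z (show 0 < ε / (2 * K) by positivity)
  have hev1 : ∀ᶠ m in atTop, ‖J m (u m) - z‖ < ε / (2 * K) := by
    simpa [dist_eq_norm] using Metric.tendsto_nhds.1 hu (ε / (2 * K)) (by positivity)
  have hev2 := (hcons ⟨x, hx⟩).norm.eventually_lt_const (lt_add_one ‖A ⟨x, hx⟩‖)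
  obtain ⟨N, hN⟩ := eventually_atTop.1 (hev1.and hev2)
  choose w hw hwu using fun m => (hAm m).exists_dist_lt (u m) hε
  refine ⟨K * (‖A ⟨x, hx⟩‖ + 1) + ∑ m ∈ Finset.range N, ‖Am m ⟨w m, hw m⟩‖, fun m => ?_⟩
  rcases lt_or_ge m N with hm | hm
  · refine ⟨⟨w m, hw m⟩, by simpa [dist_eq_norm] using (hwu m).le, ?_⟩
    have := Finset.single_le_sum (f := fun m => ‖Am m ⟨w m, hw m⟩‖)
      (fun i _ => norm_nonneg _) (Finset.mem_range.2 hm)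
    have : 0 ≤ K * (‖A ⟨x, hx⟩‖ + 1) := by positivity
    linarith
  · obtain ⟨h1, h2⟩ := hN m hm
    refine ⟨⟨P m x, hdom m x hx⟩, (hP' m (u m) x).trans ?_, ?_⟩
    · rw [dist_eq_norm] at hzx
      have h3 : ‖J m (u m) - x‖ ≤ ε / (2 * K) + ε / (2 * K) :=
        (norm_sub_le_norm_sub_add_norm_sub _ z _).trans (by linarith)
      calc K * ‖J m (u m) - x‖ ≤ K * (ε / (2 * K) + ε / (2 * K)) := by gcongr
        _ = ε := by field_simp; norm_num
    · have h3 := hP' m (Am m ⟨P m x, hdom m x hx⟩) 0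
      rw [map_zero, sub_zero, sub_zero] at h3
      have h4 : 0 ≤ ∑ m ∈ Finset.range N, ‖Am m ⟨w m, hw m⟩‖ := by positivity
      have h5 : K * ‖J m (Am m ⟨P m x, hdom m x hx⟩)‖ ≤ K * (‖A ⟨x, hx⟩‖ + 1) := by gcongr
      linarith

/-- **Consistency of the Strang splitting with rational time discretization.**
For every `x ∈ D(A) ∩ D(B)`,
`‖(J m r((h/2) A m) q(h B m) r((h/2) A m) P m x − J m P m x)/h − J m (A m + B m) P m x‖ → 0`
as `h → 0+`, uniformly in `m ∈ ℕ`. -/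
theorem strang_splitting_consistency
    (X : Type*) [NormedAddCommGroup X] [NormedSpace ℂ X] [CompleteSpace X]
    (Xm : ℕ → Type*) [∀ m, NormedAddCommGroup (Xm m)] [∀ m, NormedSpace ℂ (Xm m)]
    [∀ m, CompleteSpace (Xm m)]
    -- the approximation scheme
    (P : ∀ m, X →L[ℂ] Xm m) (J : ∀ m, Xm m →L[ℂ] X)
    (hPJ : ∀ m (y : Xm m), P m (J m y) = y)
    (hJP : ∀ x : X, Tendsto (fun m => J m (P m x)) atTop (𝓝 x))
    (K : ℝ) (hK : 0 < K) (hJnorm : ∀ m, ‖J m‖ ≤ K) (hPnorm : ∀ m, ‖P m‖ ≤ K)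
    -- the operators `A, A m`: closed and densely defined
    (A : X →ₗ.[ℂ] X) (hAclosed : IsClosed (A.graph : Set (X × X)))
    (hAdense : Dense (A.domain : Set X))
    (Am : ∀ m, Xm m →ₗ.[ℂ] Xm m)
    (hAmclosed : ∀ m, IsClosed ((Am m).graph : Set (Xm m × Xm m)))
    (hAmdense : ∀ m, Dense ((Am m).domain : Set (Xm m)))
    -- stability of the family `A, A m`
    (RA : ℂ → X →L[ℂ] X) (RAm : ∀ m, ℂ → Xm m →L[ℂ] Xm m) (MA : ℝ) (hMA : 0 ≤ MA)
    (hRA : ∀ lam : ℂ, 0 < lam.re → IsResolvent A lam (RA lam) ∧ lam.re * ‖RA lam‖ ≤ MA)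
    (hRAm : ∀ m, ∀ lam : ℂ, 0 < lam.re →
      IsResolvent (Am m) lam (RAm m lam) ∧ lam.re * ‖RAm m lam‖ ≤ MA)
    -- consistency of the family `A, A m`
    (hPdomA : ∀ m, ∀ x ∈ A.domain, P m x ∈ (Am m).domain)
    (hconsA : ∀ x : A.domain,
      Tendsto (fun m => J m ((Am m) ⟨P m (x : X), hPdomA m x x.2⟩)) atTop (𝓝 (A x)))
    -- the operators `B, B m`: closed and densely defined
    (B : X →ₗ.[ℂ] X) (hBclosed : IsClosed (B.graph : Set (X × X)))
    (hBdense : Dense (B.domain : Set X))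
    (Bm : ∀ m, Xm m →ₗ.[ℂ] Xm m)
    (hBmclosed : ∀ m, IsClosed ((Bm m).graph : Set (Xm m × Xm m)))
    (hBmdense : ∀ m, Dense ((Bm m).domain : Set (Xm m)))
    -- stability of the family `B, B m`
    (RB : ℂ → X →L[ℂ] X) (RBm : ∀ m, ℂ → Xm m →L[ℂ] Xm m) (MB : ℝ) (hMB : 0 ≤ MB)
    (hRB : ∀ lam : ℂ, 0 < lam.re → IsResolvent B lam (RB lam) ∧ lam.re * ‖RB lam‖ ≤ MB)
    (hRBm : ∀ m, ∀ lam : ℂ, 0 < lam.re →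
      IsResolvent (Bm m) lam (RBm m lam) ∧ lam.re * ‖RBm m lam‖ ≤ MB)
    -- consistency of the family `B, B m`
    (hPdomB : ∀ m, ∀ x ∈ B.domain, P m x ∈ (Bm m).domain)
    (hconsB : ∀ x : B.domain,
      Tendsto (fun m => J m ((Bm m) ⟨P m (x : X), hPdomB m x x.2⟩)) atTop (𝓝 (B x)))
    -- the rational function `r`, via its partial fraction decomposition
    (lr : ℕ) (νr : Fin lr → ℕ) (hνr : ∀ i, 1 ≤ νr i) (lamr : Fin lr → ℂ)
    (Cr : Fin lr → ℕ → ℂ) (hlamr : ∀ i, 0 < (lamr i).re)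
    (hr0 : pfdFun lr νr lamr Cr 0 = 1)
    (hr1 : HasDerivAt (pfdFun lr νr lamr Cr) 1 0)
    (hrbdd : ∃ Cb : ℝ, ∀ z : ℂ, z.re ≤ 0 → ‖pfdFun lr νr lamr Cr z‖ ≤ Cb)
    -- the rational function `q`, via its partial fraction decomposition
    (lq : ℕ) (νq : Fin lq → ℕ) (hνq : ∀ i, 1 ≤ νq i) (lamq : Fin lq → ℂ)
    (Cq : Fin lq → ℕ → ℂ) (hlamq : ∀ i, 0 < (lamq i).re)
    (hq0 : pfdFun lq νq lamq Cq 0 = 1)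
    (hq1 : HasDerivAt (pfdFun lq νq lamq Cq) 1 0)
    (hqbdd : ∃ Cb : ℝ, ∀ z : ℂ, z.re ≤ 0 → ‖pfdFun lq νq lamq Cq z‖ ≤ Cb)
 :
    ∀ x : X, ∀ hxA : x ∈ A.domain, ∀ hxB : x ∈ B.domain, ∀ ε > (0 : ℝ), ∃ δ > (0 : ℝ),
      ∀ h : ℝ, 0 < h → h < δ → ∀ m : ℕ,
        ‖((h : ℂ))⁻¹ •
            (J m (ratOp lr νr lamr Cr (RAm m) (h / 2)
                (ratOp lq νq lamq Cq (RBm m) h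
                  (ratOp lr νr lamr Cr (RAm m) (h / 2) (P m x))))
              - J m (P m x))
          - J m ((Am m) ⟨P m x, hPdomA m x hxA⟩ + (Bm m) ⟨P m x, hPdomB m x hxB⟩)‖ ≤ ε := by
  intro x hxA hxB
  have approxA {u : ∀ m, Xm m} {z : X} (hu : Tendsto (fun m => J m (u m)) atTop (𝓝 z)) :
      DomainApproximable Am u :=
    domainApproximable_of_tendsto hPJ hK hPnorm hAdense hAmdense hPdomA hconsA hu
  have approxB {u : ∀ m, Xm m} {z : X} (hu : Tendsto (fun m => J m (u m)) atTop (𝓝 z)) :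
      DomainApproximable Bm u :=
    domainApproximable_of_tendsto hPJ hK hPnorm hBdense hBmdense hPdomB hconsB hu
  have hA : Tendsto (fun m => J m (Am m ⟨P m x, hPdomA m x hxA⟩)) atTop (𝓝 (A ⟨x, hxA⟩)) :=
    hconsA ⟨x, hxA⟩
  have hB : Tendsto (fun m => J m (Bm m ⟨P m x, hPdomB m x hxB⟩)) atTop (𝓝 (B ⟨x, hxB⟩)) :=
    hconsB ⟨x, hxB⟩
  obtain ⟨cr, hcr⟩ := exists_norm_ratOp_le (ν := νr) (C := Cr) hRAm hlamr
  obtain ⟨cq, hcq⟩ := exists_norm_ratOp_le (ν := νq) (C := Cq) hRBm hlamq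
  have hcr' : ∀ m, ∀ h > 0, ‖ratOp lr νr lamr Cr (RAm m) (h / 2)‖ ≤ cr :=
    fun m h hh => hcr m _ (half_pos hh)
  have quotA := (uniformlyVanishing_ratOp_quotient hRAm hlamr hr0 hr1
    (y := fun m => ⟨P m x, hPdomA m x hxA⟩) (approxA hA)).comp_half.smul (1 / 2)
  have quotB := uniformlyVanishing_ratOp_quotient hRBm hlamq hq0 hq1
    (y := fun m => ⟨P m x, hPdomB m x hxB⟩) (approxB hB)
  have ra := (uniformlyVanishing_ratOp_sub hRAm hlamr hr0 (approxA hA)).comp_half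
  have rb := (uniformlyVanishing_ratOp_sub hRAm hlamr hr0 (approxA hB)).comp_half
  have qa := uniformlyVanishing_ratOp_sub hRBm hlamq hq0 (approxB hA)
  have main : UniformlyVanishing (fun m (h : ℝ) => (h : ℂ)⁻¹ •
            (J m (ratOp lr νr lamr Cr (RAm m) (h / 2)
                (ratOp lq νq lamq Cq (RBm m) h
                  (ratOp lr νr lamr Cr (RAm m) (h / 2) (P m x))))
              - J m (P m x)) - J m (Am m ⟨P m x, hPdomA m x hxA⟩ + Bm m ⟨P m x, hPdomB m x hxB⟩)) := by
    refine (((((((quotA.map hcq).map hcr').add ((qa.map hcr').smul (1 / 2))).add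
      (ra.smul (1 / 2))).add (quotB.map hcr')).add rb).add quotA).map
      (T := fun m _ => J m) (fun m h _ => hJnorm m) |>.congr fun m h _ => ?_
    have hscale : (1 / 2 : ℂ) * ((h / 2 : ℝ) : ℂ)⁻¹ = (h : ℂ)⁻¹ := by
      push_cast
      field_simp
    rw [← map_sub (J m), ← map_smul (J m), ← map_sub (J m)]
    congr 1
    simp only [smul_sub, map_sub, map_smul, smul_smul, hscale]
    module
  intro ε hε
  obtain ⟨δ, hδ, hsub⟩ := mem_nhdsGT_iff_exists_Ioo_subset.1 (main ε hε)
  exact ⟨δ, hδ, fun h h0 h1 => hsub ⟨h0, h1⟩⟩
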